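/- arXiv:2011.01307 — 12 statements merged into one kernel-verified Lean document; each statement's English description precedes it below -/
import Mathlib

section
/- (Representer Theorem) Let H be a real Hilbert space, X a set, k : X → H, and fix points x_1, …, x_N ∈ X. For f ∈ H write f(x) := ⟪k(x), f⟫ (the reproducing property). Let J(f) = L(f(x_1), …, f(x_N)) + R(‖f‖²), where L : ℝᴺ → ℝ is arbitrary and R : ℝ → ℝ is monotone nondecreasing. If f* minimizes J over H, then the orthogonal projection of f* onto the span of {k(x_1), …, k(x_N)} is also a minimizer of J; in particular, if a minimizer exists, there is a minimizer of the form f = ∑_{i=1}^N α_i k(x_i) with α_i ∈ ℝ. Moreover, if R is strictly increasing, then every minimizer of J lies in the span of {k(x_1), …, k(x_N)}. -/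
open scoped InnerProductSpace

/-- The Representer Theorem: a minimizer of `J(f) = L(f(x₁),…,f(x_N)) + R(‖f‖²)`,
where `R` is nondecreasing, projects orthogonally onto the span of the kernel
functions at the data points to another minimizer; that projection is of the form
`∑ αᵢ k(xᵢ)`.  If `R` is strictly increasing, every minimizer lies in the span. -/
theorem representer_theorem {H X : Type*}
    [NormedAddCommGroup H] [InnerProductSpace ℝ H] [CompleteSpace H]
    (k : X → H) {N : ℕ} (x : Fin N → X)
    (L : (Fin N → ℝ) → ℝ) (R : ℝ → ℝ) (hR : Monotone R)
    (J : H → ℝ) (hJ : ∀ f, J f = L (fun i => ⟪k (x i), f⟫_ℝ) + R (‖f‖ ^ 2))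
    (fstar : H) (hmin : ∀ f, J fstar ≤ J f) :
    (∃ g ∈ Submodule.span ℝ (Set.range fun i => k (x i)),
        fstar - g ∈ (Submodule.span ℝ (Set.range fun i => k (x i)))ᗮ ∧
        (∀ f, J g ≤ J f) ∧ ∃ α : Fin N → ℝ, g = ∑ i, α i • k (x i)) ∧
      (StrictMono R → fstar ∈ Submodule.span ℝ (Set.range fun i => k (x i))) := by
  set S := Submodule.span ℝ (Set.range fun i => k (x i))
  have hfin : FiniteDimensional ℝ S := FiniteDimensional.span_of_finite ℝ (Set.finite_range _)
  set g := S.starProjection fstar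
  have hgS : g ∈ S := S.starProjection_apply_mem fstar
  have hperp : fstar - g ∈ Sᗮ := S.sub_starProjection_mem_orthogonal fstar
  have heval : ∀ i, ⟪k (x i), g⟫_ℝ = ⟪k (x i), fstar⟫_ℝ := fun i => by
    have h := (S.mem_orthogonal _).1 hperp _ (Submodule.subset_span (Set.mem_range_self i))
    rw [inner_sub_right] at h
    linarith
  have hpyth : ‖fstar‖ ^ 2 = ‖g‖ ^ 2 + ‖fstar - g‖ ^ 2 := by
    have h := norm_add_sq_eq_norm_sq_add_norm_sq_real ((S.mem_orthogonal _).1 hperp g hgS)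
    rw [add_sub_cancel] at h
    linarith
  have hJg : J g = L (fun i => ⟪k (x i), fstar⟫_ℝ) + R (‖g‖ ^ 2) := by
    simp only [hJ, heval]
  refine ⟨⟨g, hgS, hperp, fun f => le_trans ?_ (hmin f), ?_⟩, fun hR' => ?_⟩
  · rw [hJg, hJ fstar]
    gcongr
    exact hR (hpyth ▸ le_add_of_nonneg_right (sq_nonneg _))
  · obtain ⟨α, hα⟩ := (Submodule.mem_span_range_iff_exists_fun ℝ).1 hgS
    exact ⟨α, hα.symm⟩
  · have h := hmin g
    rw [hJg, hJ fstar, add_le_add_iff_left, hR'.le_iff_le, hpyth] at h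
    have h0 : ‖fstar - g‖ = 0 := pow_eq_zero_iff two_ne_zero |>.1
      (le_antisymm (by linarith) (sq_nonneg _))
    rw [sub_eq_zero.1 (norm_eq_zero.1 h0)]
    exact hgS
end

section
/- (Graph Regularization Representer Theorem) Let H be a real Hilbert space, X a set, k : X → H, and fix points x_1, …, x_M ∈ X (M = N_L + N_U labeled plus unlabeled points). For f ∈ H write f(x) := ⟪k(x), f⟫. Let L be a symmetric positive semidefinite M × M real matrix (the Laplacian of a data graph), let L_sup : ℝ × ℝ → ℝ be a loss function, γ_K > 0, γ_I ≥ 0, y_1, …, y_{N_L} ∈ ℝ, and consider H(f) = (1/N_L) ∑_{j=1}^{N_L} L_sup(y_j, f(x_j)) + γ_K ‖f‖² + (γ_I/M²) · 𝐟ᵀ L 𝐟, where 𝐟 = (f(x_1), …, f(x_M)). Then every minimizer f* of H over H lies in the span of {k(x_1), …, k(x_M)}, i.e. f* = ∑_{i=1}^M a_i k(x_i) for some a_i ∈ ℝ. -/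
open scoped InnerProductSpace Matrix

/-- If a vector has minimal norm among the vectors with the same inner products against a finite
family, then it lies in the span of that family. -/
theorem mem_span_range_of_forall_norm_le {ι E : Type*} [Finite ι]
    [NormedAddCommGroup E] [InnerProductSpace ℝ E] (v : ι → E) (f : E)
    (h : ∀ g : E, (∀ i, ⟪v i, g⟫_ℝ = ⟪v i, f⟫_ℝ) → ‖f‖ ≤ ‖g‖) :
    f ∈ Submodule.span ℝ (Set.range v) := by
  have : FiniteDimensional ℝ (Submodule.span ℝ (Set.range v)) :=
    FiniteDimensional.span_of_finite ℝ (Set.finite_range v)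
  obtain ⟨p, hp, q, hq, rfl⟩ :=
    (Submodule.span ℝ (Set.range v)).exists_add_mem_mem_orthogonal f
  have hle : ‖p + q‖ ≤ ‖p‖ := h p fun i => by
    rw [inner_add_right, hq _ (Submodule.subset_span (Set.mem_range_self i)), add_zero]
  have hpyth := norm_add_sq_eq_norm_sq_add_norm_sq_real (hq p hp)
  have hq0 : q = 0 := norm_eq_zero.mp (by nlinarith [norm_nonneg q, norm_nonneg (p + q)])
  simpa [hq0] using hp

/-- Graph Regularization Representer Theorem: every minimizer of the
manifold-regularized objective
`H(f) = (1/N_L) ∑ⱼ L_sup(yⱼ, f(xⱼ)) + γ_K ‖f‖² + (γ_I/M²)·𝐟ᵀ L 𝐟`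
lies in the span of the kernel functions at the `M = N_L + N_U` data points. -/
theorem graph_regularization_representer_theorem {H X : Type*}
    [NormedAddCommGroup H] [InnerProductSpace ℝ H] [CompleteSpace H]
    (k : X → H) (NL NU : ℕ) (hNL : 0 < NL)
    (x : Fin (NL + NU) → X) (y : Fin NL → ℝ)
    (Lmat : Matrix (Fin (NL + NU)) (Fin (NL + NU)) ℝ) (hsym : Lmat.IsSymm)
    (hpsd : ∀ v : Fin (NL + NU) → ℝ, 0 ≤ v ⬝ᵥ (Lmat *ᵥ v))
    (Lsup : ℝ → ℝ → ℝ) (γK γI : ℝ) (hγK : 0 < γK) (hγI : 0 ≤ γI)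
    (Hfun : H → ℝ)
    (hH : ∀ f, Hfun f =
      (1 / (NL : ℝ)) * ∑ j : Fin NL, Lsup (y j) ⟪k (x (Fin.castAdd NU j)), f⟫_ℝ
      + γK * ‖f‖ ^ 2
      + (γI / ((NL + NU : ℕ) : ℝ) ^ 2) *
          ((fun i => ⟪k (x i), f⟫_ℝ) ⬝ᵥ (Lmat *ᵥ (fun i => ⟪k (x i), f⟫_ℝ))))
    (fstar : H) (hmin : ∀ f, Hfun fstar ≤ Hfun f) :
    ∃ a : Fin (NL + NU) → ℝ, fstar = ∑ i, a i • k (x i) := by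
  have hspan : fstar ∈ Submodule.span ℝ (Set.range fun i => k (x i)) := by
    refine mem_span_range_of_forall_norm_le _ _ fun g hg => ?_
    have hle := hmin g
    rw [hH, hH] at hle
    simp only [hg] at hle
    have hsq : γK * ‖fstar‖ ^ 2 ≤ γK * ‖g‖ ^ 2 := by linarith
    exact (sq_le_sq₀ (norm_nonneg _) (norm_nonneg _)).mp (le_of_mul_le_mul_left hsq hγK)
  obtain ⟨a, ha⟩ := (Submodule.mem_span_range_iff_exists_fun ℝ).mp hspan
  exact ⟨a, ha.symm⟩
end

section
/- (Regularized Least Squares closed form) Let K be a real symmetric positive semidefinite N × N matrix, y ∈ ℝᴺ, and λ > 0. Then α* = (K + λN·I)⁻¹ y minimizes the function α ↦ (1/N)(Kα − y)ᵀ(Kα − y) + λ αᵀKα over α ∈ ℝᴺ; in particular the matrix K + λN·I is invertible. -/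
open scoped Matrix

/-- Adding a positive multiple of the identity to a matrix with nonnegative quadratic form
gives an invertible matrix. -/
theorem Matrix.isUnit_add_smul_one_of_dotProduct_mulVec_nonneg {n : Type*} [Fintype n]
    [DecidableEq n] {K : Matrix n n ℝ} (hK : ∀ v : n → ℝ, 0 ≤ v ⬝ᵥ (K *ᵥ v))
    {c : ℝ} (hc : 0 < c) : IsUnit (K + c • (1 : Matrix n n ℝ)) := by
  rw [← Matrix.mulVec_injective_iff_isUnit, ← Matrix.coe_mulVecLin, injective_iff_map_eq_zero]
  intro v hv
  have h : v ⬝ᵥ (K *ᵥ v) + c * (v ⬝ᵥ v) = 0 := by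
    simpa [Matrix.add_mulVec, Matrix.smul_mulVec, dotProduct_add] using
      congrArg (fun w => v ⬝ᵥ w) hv
  have h_nonneg : 0 ≤ v ⬝ᵥ v := Finset.sum_nonneg fun i _ => mul_self_nonneg (v i)
  exact dotProduct_self_eq_zero.mp (by nlinarith [hK v])

/-- A solution of the regularized normal equations minimizes the regularized least-squares
objective. -/
theorem Matrix.regularized_objective_le {n : Type*} [Fintype n] {K : Matrix n n ℝ}
    (hsym : K.IsSymm) (hK : ∀ v : n → ℝ, 0 ≤ v ⬝ᵥ (K *ᵥ v)) {m lam : ℝ} (hm : 0 < m)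
    (hlam : 0 ≤ lam) {a y : n → ℝ} (ha : K *ᵥ a + (lam * m) • a = y) (b : n → ℝ) :
    (1 / m) * ((K *ᵥ a - y) ⬝ᵥ (K *ᵥ a - y)) + lam * (a ⬝ᵥ (K *ᵥ a)) ≤
      (1 / m) * ((K *ᵥ b - y) ⬝ᵥ (K *ᵥ b - y)) + lam * (b ⬝ᵥ (K *ᵥ b)) := by
  obtain ⟨d, rfl⟩ : ∃ d, b = a + d := ⟨b - a, by simp⟩
  have h_comm : d ⬝ᵥ (K *ᵥ a) = a ⬝ᵥ (K *ᵥ d) := by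
    rw [Matrix.dotProduct_mulVec, ← Matrix.mulVec_transpose, hsym.eq, dotProduct_comm]
  have h_a : K *ᵥ a - y = -((lam * m) • a) := by rw [← ha]; abel
  have h_b : K *ᵥ (a + d) - y = K *ᵥ d - (lam * m) • a := by
    rw [← ha, Matrix.mulVec_add]; abel
  have h_gap : (1 / m) * ((K *ᵥ (a + d) - y) ⬝ᵥ (K *ᵥ (a + d) - y))
        + lam * ((a + d) ⬝ᵥ (K *ᵥ (a + d)))
      = (1 / m) * ((K *ᵥ a - y) ⬝ᵥ (K *ᵥ a - y)) + lam * (a ⬝ᵥ (K *ᵥ a))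
        + ((1 / m) * ((K *ᵥ d) ⬝ᵥ (K *ᵥ d)) + lam * (d ⬝ᵥ (K *ᵥ d))) := by
    rw [h_a, h_b]
    simp only [Matrix.mulVec_add, add_dotProduct, dotProduct_add, sub_dotProduct, dotProduct_sub,
      smul_dotProduct, dotProduct_smul, neg_dotProduct, dotProduct_neg, smul_eq_mul, h_comm,
      dotProduct_comm (K *ᵥ d) a]
    field_simp
    ring
  have h_sq : 0 ≤ (K *ᵥ d) ⬝ᵥ (K *ᵥ d) := Finset.sum_nonneg fun i _ => mul_self_nonneg _
  have h_quad := hK d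
  rw [h_gap]
  exact le_add_of_nonneg_right (by positivity)

/-- Regularized least squares closed form: for a symmetric positive semidefinite
matrix `K` and `λ > 0`, the matrix `K + λN·I` is invertible and
`α* = (K + λN·I)⁻¹ y` minimizes the regularized least-squares objective. -/
theorem regularized_least_squares_closed_form {N : ℕ} (hN : 0 < N)
    (K : Matrix (Fin N) (Fin N) ℝ) (hsym : K.IsSymm)
    (hpsd : ∀ α : Fin N → ℝ, 0 ≤ α ⬝ᵥ (K *ᵥ α))
    (y : Fin N → ℝ) (lam : ℝ) (hlam : 0 < lam) :
    IsUnit (K + (lam * N) • (1 : Matrix (Fin N) (Fin N) ℝ)) ∧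
    ∀ α : Fin N → ℝ,
      (1 / (N : ℝ)) * ((K *ᵥ ((K + (lam * N) • 1)⁻¹ *ᵥ y) - y) ⬝ᵥ
          (K *ᵥ ((K + (lam * N) • 1)⁻¹ *ᵥ y) - y))
        + lam * (((K + (lam * N) • 1)⁻¹ *ᵥ y) ⬝ᵥ (K *ᵥ ((K + (lam * N) • 1)⁻¹ *ᵥ y)))
      ≤ (1 / (N : ℝ)) * ((K *ᵥ α - y) ⬝ᵥ (K *ᵥ α - y)) + lam * (α ⬝ᵥ (K *ᵥ α)) := by
  have hN' : (0 : ℝ) < N := Nat.cast_pos.mpr hN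
  have h_unit := Matrix.isUnit_add_smul_one_of_dotProduct_mulVec_nonneg hpsd (mul_pos hlam hN')
  refine ⟨h_unit, Matrix.regularized_objective_le hsym hpsd hN' hlam.le ?_⟩
  have h := Matrix.mul_nonsing_inv _ ((Matrix.isUnit_iff_isUnit_det _).mp h_unit)
  simpa [Matrix.add_mul, Matrix.add_mulVec, Matrix.smul_mulVec] using
    congrArg (fun M => M *ᵥ y) h
end

section
/- Let G be a simple graph on n vertices with Laplacian matrix L = D − A. Then every eigenvalue of L is at most n; moreover, n is an eigenvalue of L if and only if the complement graph Ḡ is disconnected. -/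
open scoped Matrix

namespace SimpleGraph

variable {V : Type*} [Fintype V] [DecidableEq V] (G : SimpleGraph V) [DecidableRel G.Adj]

theorem lapMatrix_mulVec_apply_eq_sum_ite (v : V → ℝ) (i : V) :
    (G.lapMatrix ℝ *ᵥ v) i = ∑ j, if G.Adj i j then v i - v j else 0 := by
  rw [lapMatrix_mulVec_apply, ← Finset.sum_filter, Finset.sum_sub_distrib, Finset.sum_const,
    ← neighborFinset_eq_filter, card_neighborFinset_eq_degree, nsmul_eq_mul]

theorem lapMatrix_mulVec_add_lapMatrix_compl_mulVec (v : V → ℝ) (i : V) :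
    (G.lapMatrix ℝ *ᵥ v) i + (Gᶜ.lapMatrix ℝ *ᵥ v) i = Fintype.card V * v i - ∑ j, v j := by
  have hsum : (Fintype.card V * v i - ∑ j, v j : ℝ) = ∑ j, (v i - v j) := by
    simp [Finset.sum_sub_distrib]
  rw [lapMatrix_mulVec_apply_eq_sum_ite, lapMatrix_mulVec_apply_eq_sum_ite,
    ← Finset.sum_add_distrib, hsum]
  refine Finset.sum_congr rfl fun j _ ↦ ?_
  by_cases hij : i = j
  · simp [hij]
  · by_cases h : G.Adj i j <;> simp [compl_adj, h, hij]

theorem sum_lapMatrix_mulVec (v : V → ℝ) : ∑ i, (G.lapMatrix ℝ *ᵥ v) i = 0 := by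
  have h : (fun _ ↦ 1) ⬝ᵥ (G.lapMatrix ℝ *ᵥ v) = 0 := by
    rw [Matrix.dotProduct_mulVec, ← Matrix.mulVec_transpose, G.isSymm_lapMatrix ℝ,
      lapMatrix_mulVec_const_eq_zero, zero_dotProduct]
  simpa [dotProduct] using h

theorem sum_eq_zero_of_lapMatrix_mulVec_eq_smul {v : V → ℝ} {μ : ℝ} (hμ : μ ≠ 0)
    (hv : G.lapMatrix ℝ *ᵥ v = μ • v) : ∑ i, v i = 0 := by
  have h := G.sum_lapMatrix_mulVec v
  simp only [hv, Pi.smul_apply, smul_eq_mul, ← Finset.mul_sum] at h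
  exact (mul_eq_zero.mp h).resolve_left hμ

theorem lapMatrix_compl_mulVec_eq_smul {v : V → ℝ} {μ : ℝ} (hμ : μ ≠ 0)
    (hv : G.lapMatrix ℝ *ᵥ v = μ • v) :
    Gᶜ.lapMatrix ℝ *ᵥ v = (Fintype.card V - μ) • v := by
  ext i
  have h := G.lapMatrix_mulVec_add_lapMatrix_compl_mulVec v i
  rw [G.sum_eq_zero_of_lapMatrix_mulVec_eq_smul hμ hv, hv] at h
  simp only [Pi.smul_apply, smul_eq_mul] at h ⊢
  linarith

theorem nonneg_of_lapMatrix_mulVec_eq_smul {v : V → ℝ} {μ : ℝ} (hv0 : v ≠ 0)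
    (hv : G.lapMatrix ℝ *ᵥ v = μ • v) : 0 ≤ μ := by
  have h := (posSemidef_lapMatrix ℝ G).dotProduct_mulVec_nonneg v
  rw [hv, dotProduct_smul, smul_eq_mul] at h
  exact nonneg_of_mul_nonneg_left h (Matrix.dotProduct_star_self_pos_iff.mpr hv0)

theorem le_card_of_lapMatrix_mulVec_eq_smul {v : V → ℝ} {μ : ℝ} (hv0 : v ≠ 0)
    (hv : G.lapMatrix ℝ *ᵥ v = μ • v) : μ ≤ Fintype.card V := by
  by_cases hμ : μ = 0
  · simp [hμ]
  · exact sub_nonneg.mp <|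
      Gᶜ.nonneg_of_lapMatrix_mulVec_eq_smul hv0 (G.lapMatrix_compl_mulVec_eq_smul hμ hv)

theorem exists_lapMatrix_mulVec_eq_card_smul_iff [Nonempty V] :
    (∃ v : V → ℝ, v ≠ 0 ∧ G.lapMatrix ℝ *ᵥ v = (Fintype.card V : ℝ) • v) ↔
      ¬ Gᶜ.Connected := by
  have hcard : (Fintype.card V : ℝ) ≠ 0 := Nat.cast_ne_zero.mpr Fintype.card_ne_zero
  constructor
  · rintro ⟨v, hv0, hv⟩ hconn
    have hsum := G.sum_eq_zero_of_lapMatrix_mulVec_eq_smul hcard hv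
    have hker := G.lapMatrix_compl_mulVec_eq_smul hcard hv
    rw [sub_self, zero_smul, lapMatrix_mulVec_eq_zero_iff_forall_reachable] at hker
    refine hv0 (funext fun i ↦ ?_)
    rw [Finset.sum_congr rfl fun j _ ↦ hker j i (hconn.preconnected j i)] at hsum
    simpa using hsum
  · intro hconn
    obtain ⟨i, j, hij⟩ : ∃ i j, ¬ Gᶜ.Reachable i j := by
      by_contra! h
      exact hconn ⟨h⟩
    classical
    let w : V → ℝ := fun k ↦ if Gᶜ.Reachable i k then 1 else 0
    let v : V → ℝ := fun k ↦ Fintype.card V * w k - ∑ l, w l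
    have hker : Gᶜ.lapMatrix ℝ *ᵥ v = 0 := by
      rw [lapMatrix_mulVec_eq_zero_iff_forall_reachable]
      intro k l hkl
      have : Gᶜ.Reachable i k ↔ Gᶜ.Reachable i l :=
        ⟨fun h ↦ h.trans hkl, fun h ↦ h.trans hkl.symm⟩
      simp [v, w, this]
    have hsum : ∑ k, v k = 0 := by
      simp [v, Finset.sum_sub_distrib, ← Finset.mul_sum]
    refine ⟨v, fun h ↦ hcard ?_, ?_⟩
    · have hi := congrFun h i
      have hj := congrFun h j
      simp only [v, w, hij, Reachable.refl, if_true, if_false, Pi.zero_apply] at hi hj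
      linarith
    · ext k
      have h := G.lapMatrix_mulVec_add_lapMatrix_compl_mulVec v k
      rw [hker, hsum] at h
      simpa using h

end SimpleGraph

/-- Every Laplacian eigenvalue of a simple graph on `n ≥ 1` vertices is at most `n`,
and `n` is an eigenvalue if and only if the complement graph is disconnected. -/
theorem lapMatrix_eigenvalue_le_card_and_top_iff_compl_disconnected
    {n : ℕ} (hn : 0 < n) (G : SimpleGraph (Fin n)) [DecidableRel G.Adj] :
    (∀ μ : ℝ, (∃ v : Fin n → ℝ, v ≠ 0 ∧ (G.lapMatrix ℝ) *ᵥ v = μ • v) → μ ≤ n) ∧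
    ((∃ v : Fin n → ℝ, v ≠ 0 ∧ (G.lapMatrix ℝ) *ᵥ v = (n : ℝ) • v) ↔ ¬ Gᶜ.Connected) := by
  have : Nonempty (Fin n) := ⟨⟨0, hn⟩⟩
  constructor
  · rintro μ ⟨v, hv0, hv⟩
    simpa using G.le_card_of_lapMatrix_mulVec_eq_smul hv0 hv
  · simpa using G.exists_lapMatrix_mulVec_eq_card_smul_iff
end

section
/- (Fiedler) Let G be a simple graph on n ≥ 2 vertices with Laplacian matrix L, and let 0 = λ_1 ≤ λ_2 ≤ … ≤ λ_n be its eigenvalues listed in increasing order with multiplicity. Then λ_2 ≤ (n/(n−1)) · min_{v ∈ V} deg(v). -/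
open scoped Matrix

namespace SimpleGraph

/-- The Laplacian quadratic form at a coordinate vector shifted by a constant is the degree. -/
theorem dotProduct_lapMatrix_mulVec_single_sub_const {V : Type*} [Fintype V] [DecidableEq V]
    (G : SimpleGraph V) [DecidableRel G.Adj] (v : V) (a : ℝ) :
    (Pi.single v 1 - a • fun _ => 1) ⬝ᵥ (G.lapMatrix ℝ *ᵥ (Pi.single v 1 - a • fun _ => 1)) =
      G.degree v := by
  have hright : G.lapMatrix ℝ *ᵥ (fun _ => 1) = 0 := G.lapMatrix_mulVec_const_eq_zero
  have hleft : (fun _ => 1) ᵥ* G.lapMatrix ℝ = 0 := by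
    rw [← Matrix.mulVec_transpose, (G.isSymm_lapMatrix (R := ℝ)).eq, hright]
  rw [Matrix.mulVec_sub, Matrix.mulVec_smul, hright, smul_zero, sub_zero, sub_dotProduct,
    smul_dotProduct, Matrix.dotProduct_mulVec (fun _ => 1), hleft]
  simp [lapMatrix, degMatrix]

end SimpleGraph

/-- Fiedler's bound: the second smallest Laplacian eigenvalue `λ₂`, characterized
as the minimum of the Rayleigh quotient over unit vectors orthogonal to the
all-ones vector, satisfies `λ₂ ≤ (n/(n−1)) · min_v deg(v)`. -/
theorem fiedler_lambda_two_le {n : ℕ} (hn : 2 ≤ n)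
    (G : SimpleGraph (Fin n)) [DecidableRel G.Adj] (lam2 : ℝ)
    (hlam2 : IsLeast {r : ℝ | ∃ x : Fin n → ℝ, (∑ i, x i ^ 2) = 1 ∧ (∑ i, x i) = 0 ∧
        r = x ⬝ᵥ ((G.lapMatrix ℝ) *ᵥ x)} lam2) :
    lam2 ≤ ((n : ℝ) / ((n : ℝ) - 1)) * ⨅ v : Fin n, (G.degree v : ℝ) := by
  have hn' : (0 : ℝ) < n - 1 := by
    have : (2 : ℝ) ≤ n := by exact_mod_cast hn
    linarith
  have hn0 : (n : ℝ) ≠ 0 := by linarith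
  have : Nonempty (Fin n) := ⟨⟨0, by omega⟩⟩
  obtain ⟨v, hv⟩ := exists_eq_ciInf_of_finite (f := fun v : Fin n => (G.degree v : ℝ))
  rw [← hv]
  have hc : √((n : ℝ) / (n - 1)) ^ 2 = n / (n - 1) := Real.sq_sqrt (by positivity)
  have hsum : ∑ i, (Pi.single v 1 : Fin n → ℝ) i = 1 := by simp
  have hsq : ∑ i, (Pi.single v 1 : Fin n → ℝ) i ^ 2 = 1 := by simp [Pi.single_apply]
  refine hlam2.2 ⟨√((n : ℝ) / (n - 1)) • (Pi.single v 1 - (n : ℝ)⁻¹ • fun _ => 1), ?_, ?_, ?_⟩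
  · simp only [Pi.smul_apply, Pi.sub_apply, smul_eq_mul, mul_one, mul_pow, ← Finset.mul_sum,
      sub_sq, Finset.sum_add_distrib, Finset.sum_sub_distrib, ← Finset.sum_mul, hsum, hsq, hc,
      Finset.sum_const, Finset.card_univ, Fintype.card_fin, nsmul_eq_mul]
    field_simp
    ring
  · simp only [Pi.smul_apply, Pi.sub_apply, smul_eq_mul, mul_one, ← Finset.mul_sum,
      Finset.sum_sub_distrib, hsum, Finset.sum_const, Finset.card_univ, Fintype.card_fin,
      nsmul_eq_mul, mul_inv_cancel₀ hn0, sub_self, mul_zero]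
  · rw [Matrix.mulVec_smul, smul_dotProduct, dotProduct_smul,
      G.dotProduct_lapMatrix_mulVec_single_sub_const, smul_eq_mul, smul_eq_mul, ← mul_assoc,
      ← sq, hc]
end

section
/- (Fiedler) Let G be a simple graph on n ≥ 2 vertices with Laplacian matrix L, and let 0 = λ_1 ≤ λ_2 ≤ … ≤ λ_n be its eigenvalues listed in increasing order with multiplicity. Then λ_n ≥ (n/(n−1)) · max_{v ∈ V} deg(v). -/
open scoped Matrix

/-- The Laplacian quadratic form at a basis vector is the degree, also after subtracting a
constant vector, which lies in the kernel. -/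
lemma lapMatrix_quadraticForm_single_sub_const {V : Type*} [Fintype V] [DecidableEq V]
    (G : SimpleGraph V) [DecidableRel G.Adj] (v : V) (c : ℝ) :
    (Pi.single v 1 - c • fun _ => 1) ⬝ᵥ (G.lapMatrix ℝ *ᵥ (Pi.single v 1 - c • fun _ => 1)) =
      (G.degree v : ℝ) := by
  have hconst := G.lapMatrix_mulVec_const_eq_zero (R := ℝ)
  have hleft : (fun _ => (1 : ℝ)) ᵥ* G.lapMatrix ℝ = 0 := by
    rw [← Matrix.mulVec_transpose, (G.isSymm_lapMatrix (R := ℝ)).eq, hconst]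
  rw [Matrix.mulVec_sub, Matrix.mulVec_smul, hconst, smul_zero, sub_zero, sub_dotProduct,
    smul_dotProduct, Matrix.dotProduct_mulVec (fun _ => (1 : ℝ)), hleft]
  simp [SimpleGraph.lapMatrix, SimpleGraph.degMatrix]

lemma sum_sq_single_sub_average {V : Type*} [Fintype V] [DecidableEq V] (v : V) :
    ∑ i, (Pi.single v 1 - (Fintype.card V : ℝ)⁻¹ • fun _ => 1 : V → ℝ) i ^ 2 =
      1 - (Fintype.card V : ℝ)⁻¹ := by
  have : Nonempty V := ⟨v⟩
  have hcard : (Fintype.card V : ℝ) ≠ 0 := Nat.cast_ne_zero.2 Fintype.card_ne_zero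
  simp only [Pi.sub_apply, Pi.smul_apply, smul_eq_mul, mul_one, sub_sq, Finset.sum_add_distrib,
    Finset.sum_sub_distrib, ← Finset.sum_mul, ← Finset.mul_sum, Pi.single_apply, ite_pow]
  simp
  field_simp
  ring

/-- An upper bound of a quadratic form on unit vectors bounds it on every vector of positive
length, by homogeneity. -/
lemma dotProduct_mulVec_le_mul_sum_sq {V : Type*} [Fintype V] (A : Matrix V V ℝ) {lam : ℝ}
    (h : lam ∈ upperBounds {r : ℝ | ∃ x : V → ℝ, (∑ i, x i ^ 2) = 1 ∧ r = x ⬝ᵥ (A *ᵥ x)})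
    (y : V → ℝ) (hy : 0 < ∑ i, y i ^ 2) : y ⬝ᵥ (A *ᵥ y) ≤ lam * ∑ i, y i ^ 2 := by
  set s := ∑ i, y i ^ 2 with hs
  have hsq : (√s)⁻¹ ^ 2 = s⁻¹ := by rw [inv_pow, Real.sq_sqrt hy.le]
  have hunit : ∑ i, ((√s)⁻¹ • y) i ^ 2 = 1 := by
    simp only [Pi.smul_apply, smul_eq_mul, mul_pow, ← Finset.mul_sum, hsq, ← hs]
    exact inv_mul_cancel₀ hy.ne'
  have hle := h ⟨_, hunit, rfl⟩
  rw [Matrix.mulVec_smul, smul_dotProduct, dotProduct_smul, smul_smul, ← sq, hsq, smul_eq_mul,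
    inv_mul_le_iff₀ hy] at hle
  linarith

/-- Fiedler's bound: the largest Laplacian eigenvalue `λ_n`, characterized as the
maximum of the Rayleigh quotient over unit vectors, satisfies
`λ_n ≥ (n/(n−1)) · max_v deg(v)`. -/
theorem fiedler_lambda_n_ge {n : ℕ} (hn : 2 ≤ n)
    (G : SimpleGraph (Fin n)) [DecidableRel G.Adj] (lamn : ℝ)
    (hlamn : IsGreatest {r : ℝ | ∃ x : Fin n → ℝ, (∑ i, x i ^ 2) = 1 ∧
        r = x ⬝ᵥ ((G.lapMatrix ℝ) *ᵥ x)} lamn) :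
    ((n : ℝ) / ((n : ℝ) - 1)) * ⨆ v : Fin n, (G.degree v : ℝ) ≤ lamn := by
  have : Nonempty (Fin n) := ⟨⟨0, by omega⟩⟩
  have hn' : (2 : ℝ) ≤ n := by exact_mod_cast hn
  have hpos : (0 : ℝ) < n - 1 := by linarith
  obtain ⟨v, hv⟩ := exists_eq_ciSup_of_finite (f := fun v : Fin n => (G.degree v : ℝ))
  have hnorm := sum_sq_single_sub_average v
  rw [Fintype.card_fin] at hnorm
  have hlt : (0 : ℝ) < 1 - (n : ℝ)⁻¹ := sub_pos.2 (inv_lt_one_of_one_lt₀ (by linarith))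
  have hle := dotProduct_mulVec_le_mul_sum_sq _ hlamn.2 _ (hnorm ▸ hlt)
  rw [lapMatrix_quadraticForm_single_sub_const, hnorm] at hle
  rw [← hv, div_mul_eq_mul_div, div_le_iff₀ hpos]
  calc (n : ℝ) * G.degree v ≤ n * (lamn * (1 - (n : ℝ)⁻¹)) := by gcongr
    _ = lamn * (n - 1) := by field_simp
end

section
/- (Anderson–Morley) Let G be a finite simple graph with at least one edge and Laplacian matrix L, and let λ_n denote the largest eigenvalue of L. Then λ_n ≤ max_{(i,j) ∈ E} (deg(i) + deg(j)), the maximum over edges of the sum of the degrees of the two endpoints. -/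
open scoped Matrix

theorem SimpleGraph.lapMatrix_mulVec_apply_eq_sum_sub {V R : Type*} [Fintype V] [DecidableEq V]
    [NonAssocRing R] (G : SimpleGraph V) [DecidableRel G.Adj] (v : V → R) (i : V) :
    (G.lapMatrix R *ᵥ v) i = ∑ k ∈ G.neighborFinset i, (v i - v k) := by
  rw [SimpleGraph.lapMatrix_mulVec_apply, Finset.sum_sub_distrib, Finset.sum_const,
    SimpleGraph.card_neighborFinset_eq_degree, nsmul_eq_mul]

theorem SimpleGraph.lapMatrix_mulVec_apply_le {V : Type*} [Fintype V] [DecidableEq V]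
    (G : SimpleGraph V) [DecidableRel G.Adj] {v : V → ℝ} {i : V} {m : ℝ}
    (h : ∀ k, G.Adj i k → v i - v k ≤ m) :
    (G.lapMatrix ℝ *ᵥ v) i ≤ G.degree i * m := by
  rw [G.lapMatrix_mulVec_apply_eq_sum_sub, ← nsmul_eq_mul,
    ← SimpleGraph.card_neighborFinset_eq_degree]
  exact Finset.sum_le_card_nsmul _ _ _ fun k hk => h k (by simpa using hk)

/-- An eigenvalue of the Laplacian is at most the degree sum of some edge: take an edge along which
the eigenvector drops the most. -/
theorem SimpleGraph.exists_adj_eigenvalue_lapMatrix_le {V : Type*} [Fintype V] [DecidableEq V]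
    (G : SimpleGraph V) [DecidableRel G.Adj] (hE : G.edgeSet.Nonempty) {μ : ℝ} {v : V → ℝ}
    (hv : v ≠ 0) (h : G.lapMatrix ℝ *ᵥ v = μ • v) :
    ∃ i j, G.Adj i j ∧ μ ≤ G.degree i + G.degree j := by
  obtain ⟨⟨a, b⟩, hab⟩ := hE
  obtain ⟨⟨i, j⟩, hij, hmax⟩ := (Finset.univ.filter fun p : V × V => G.Adj p.1 p.2).exists_max_image
    (fun p => v p.1 - v p.2) ⟨(a, b), by simpa using hab⟩
  replace hij : G.Adj i j := by simpa using hij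
  replace hmax : ∀ k l, G.Adj k l → v k - v l ≤ v i - v j := fun k l hkl =>
    hmax (k, l) (by simpa using hkl)
  refine ⟨i, j, hij, ?_⟩
  rcases (show 0 ≤ v i - v j by linarith [hmax j i hij.symm]).eq_or_lt with h0 | hpos
  · have hL : G.lapMatrix ℝ *ᵥ v = 0 := by
      rw [SimpleGraph.lapMatrix_mulVec_eq_zero_iff_forall_adj]
      intro k l hkl
      linarith [hmax k l hkl, hmax l k hkl.symm]
    have hμ : μ = 0 := (smul_eq_zero.mp (h.symm.trans hL)).resolve_right hv
    rw [hμ]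
    positivity
  · have hi := G.lapMatrix_mulVec_apply_le fun k hk => hmax i k hk
    have hj := G.lapMatrix_mulVec_apply_le (v := -v) (i := j) (m := v i - v j) fun k hk => by
      simp only [Pi.neg_apply]
      linarith [hmax k j hk.symm]
    rw [Matrix.mulVec_neg] at hj
    simp only [h, Pi.neg_apply, Pi.smul_apply, smul_eq_mul] at hi hj
    refine le_of_mul_le_mul_right ?_ hpos
    linarith

/-- Anderson–Morley bound: the largest Laplacian eigenvalue of a graph with at
least one edge is at most the maximum over edges of the sum of the degrees of
the two endpoints. -/
theorem anderson_morley_bound {V : Type*} [Fintype V] [DecidableEq V]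
    (G : SimpleGraph V) [DecidableRel G.Adj]
    (hE : G.edgeSet.Nonempty) (lamn : ℝ)
    (hlam : IsGreatest {μ : ℝ | ∃ v : V → ℝ, v ≠ 0 ∧ (G.lapMatrix ℝ) *ᵥ v = μ • v} lamn) :
    lamn ≤ sSup {s : ℝ | ∃ i j, G.Adj i j ∧ s = (G.degree i : ℝ) + (G.degree j : ℝ)} := by
  obtain ⟨v, hv, h⟩ := hlam.1
  obtain ⟨i, j, hij, hle⟩ := G.exists_adj_eigenvalue_lapMatrix_le hE hv h
  refine hle.trans (le_csSup (Set.Finite.bddAbove ?_) ⟨i, j, hij, rfl⟩)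
  refine (Set.finite_range fun p : V × V => (G.degree p.1 : ℝ) + G.degree p.2).subset ?_
  rintro _ ⟨k, l, -, rfl⟩
  exact ⟨(k, l), rfl⟩
end

section
/- (Merris) Let G be a finite simple graph with minimum degree at least 1 and Laplacian matrix L, and let λ_n denote the largest eigenvalue of L. For each vertex i, let m(i) = (1/deg(i)) ∑_{j ∈ N(i)} deg(j) be the average of the degrees of the vertices adjacent to i. Then λ_n ≤ max_{i ∈ V} (deg(i) + m(i)). -/
open scoped Matrix

/-- Merris' bound: for a graph with minimum degree at least one, the largest
Laplacian eigenvalue is at most `max_i (deg(i) + m(i))`, where `m(i)` is the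
average degree of the neighbors of `i`. -/
theorem merris_bound {V : Type*} [Fintype V] [DecidableEq V]
    (G : SimpleGraph V) [DecidableRel G.Adj]
    (hdeg : ∀ v : V, 1 ≤ G.degree v) (lamn : ℝ)
    (hlam : IsGreatest {μ : ℝ | ∃ v : V → ℝ, v ≠ 0 ∧ (G.lapMatrix ℝ) *ᵥ v = μ • v} lamn) :
    lamn ≤ ⨆ i : V, ((G.degree i : ℝ) +
      (∑ j ∈ G.neighborFinset i, (G.degree j : ℝ)) / (G.degree i : ℝ)) := by
  obtain ⟨⟨x, hx0, hx⟩, -⟩ := hlam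
  have hpos (v : V) : (0 : ℝ) < G.degree v := by exact_mod_cast hdeg v
  obtain ⟨k, hk⟩ := Function.ne_iff.mp hx0
  have : Nonempty V := ⟨k⟩
  obtain ⟨i, hi⟩ := Finite.exists_max fun v => |x v| / (G.degree v : ℝ)
  have hxi : 0 < |x i| := by
    have h := (div_pos (abs_pos.mpr hk) (hpos k)).trans_le (hi k)
    exact (div_pos_iff_of_pos_right (hpos i)).mp h
  have hrow := congrFun hx i
  rw [SimpleGraph.lapMatrix_mulVec_apply, Pi.smul_apply, smul_eq_mul] at hrow
  have hsum : ∑ j ∈ G.neighborFinset i, |x j| ≤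
      (∑ j ∈ G.neighborFinset i, (G.degree j : ℝ)) / G.degree i * |x i| := by
    calc ∑ j ∈ G.neighborFinset i, |x j|
        ≤ ∑ j ∈ G.neighborFinset i, |x i| / G.degree i * G.degree j :=
          Finset.sum_le_sum fun j _ => (div_le_iff₀ (hpos j)).mp (hi j)
      _ = _ := by rw [← Finset.mul_sum]; ring
  have habs : (lamn - G.degree i) * |x i| ≤ ∑ j ∈ G.neighborFinset i, |x j| := by
    calc (lamn - G.degree i) * |x i| ≤ |lamn - G.degree i| * |x i| := by
          gcongr
          exact le_abs_self _
      _ = |∑ j ∈ G.neighborFinset i, x j| := by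
          rw [← abs_mul, ← abs_neg]
          congr 1
          linarith
      _ ≤ _ := Finset.abs_sum_le_sum_abs _ _
  have hbound := le_of_mul_le_mul_right (habs.trans hsum) hxi
  refine le_ciSup_of_le (Set.finite_range _).bddAbove i ?_
  linarith
end

section
/- Let G be a finite simple graph on vertex set V and let S ⊂ V be a subset of vertices. Let G∖S denote the graph obtained from G by deleting all vertices in S together with all edges incident to S. Then λ_2(G) ≤ λ_2(G∖S) + |S|, where λ_2 denotes the second smallest Laplacian eigenvalue (with multiplicity) of the respective graph (assuming both graphs have at least 2 vertices). -/
open scoped Matrix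

/-- The Laplacian quadratic form as a double sum over ordered adjacent pairs. -/
theorem dotProduct_lapMatrix_mulVec {V : Type*} [Fintype V] [DecidableEq V]
    (G : SimpleGraph V) [DecidableRel G.Adj] (x : V → ℝ) :
    x ⬝ᵥ (G.lapMatrix ℝ *ᵥ x) = ∑ i, ∑ j, if G.Adj i j then x i ^ 2 - x i * x j else 0 := by
  refine Finset.sum_congr rfl fun i _ => ?_
  rw [SimpleGraph.lapMatrix_mulVec_apply, ← Finset.sum_filter, ← SimpleGraph.neighborFinset_eq_filter,
    Finset.sum_sub_distrib, Finset.sum_const, ← Finset.mul_sum, SimpleGraph.card_neighborFinset_eq_degree,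
    nsmul_eq_mul]
  ring

/-- Removing a set `S` of vertices decreases the second Laplacian eigenvalue by
at most `|S|`:  `λ₂(G) ≤ λ₂(G∖S) + |S|`, with `λ₂` characterized as the minimum
of the Rayleigh quotient over unit vectors orthogonal to the all-ones vector. -/
theorem lambda_two_le_lambda_two_delete_add_card
    {V : Type*} [Fintype V] [DecidableEq V]
    (G : SimpleGraph V) [DecidableRel G.Adj]
    (S : Finset V) [DecidableRel (G.induce ((↑(Sᶜ) : Set V))).Adj]
    (hV : 2 ≤ Fintype.card V) (hVS : 2 ≤ Fintype.card ((↑(Sᶜ) : Set V)))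
    (lam2G lam2GS : ℝ)
    (h1 : IsLeast {r : ℝ | ∃ x : V → ℝ, (∑ v, x v ^ 2) = 1 ∧ (∑ v, x v) = 0 ∧
        r = x ⬝ᵥ ((G.lapMatrix ℝ) *ᵥ x)} lam2G)
    (h2 : IsLeast {r : ℝ | ∃ x : ((↑(Sᶜ) : Set V)) → ℝ,
        (∑ v, x v ^ 2) = 1 ∧ (∑ v, x v) = 0 ∧
        r = x ⬝ᵥ (((G.induce ((↑(Sᶜ) : Set V))).lapMatrix ℝ) *ᵥ x)} lam2GS) :
    lam2G ≤ lam2GS + (S.card : ℝ) := by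
  obtain ⟨⟨x, hx2, hx1, hxE⟩, -⟩ := h2
  set y : V → ℝ := fun v => if h : v ∈ (↑(Sᶜ) : Set V) then x ⟨v, h⟩ else 0 with hy
  have hyx : ∀ v : (↑(Sᶜ) : Set V), y v = x v := fun v => dif_pos v.2
  have hy0 : ∀ v ∈ S, y v = 0 := fun v hv => dif_neg (by simpa using hv)
  have hsub : ∀ f : V → ℝ, ∑ v ∈ Sᶜ, f v = ∑ v : (↑(Sᶜ) : Set V), f v :=
    fun f => Finset.sum_subtype _ (fun _ => Finset.mem_coe.symm) f
  have hsum : ∀ f : V → ℝ, (∀ v ∈ S, f v = 0) → ∑ v, f v = ∑ v : (↑(Sᶜ) : Set V), f v := by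
    intro f hf
    rw [← Finset.sum_add_sum_compl S f, Finset.sum_eq_zero hf, zero_add, hsub]
  have hle : lam2G ≤ y ⬝ᵥ (G.lapMatrix ℝ *ᵥ y) := by
    refine h1.2 ⟨y, ?_, ?_, rfl⟩
    · rw [hsum _ fun v hv => by simp [hy0 v hv]]
      simpa only [hyx] using hx2
    · rw [hsum _ hy0]
      simpa only [hyx] using hx1
  refine hle.trans ?_
  rw [hxE, dotProduct_lapMatrix_mulVec, dotProduct_lapMatrix_mulVec,
    hsum _ fun v hv => Finset.sum_eq_zero fun j _ => by simp [hy0 v hv],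
    ← mul_one (S.card : ℝ), ← hx2, Finset.mul_sum, ← Finset.sum_add_distrib]
  refine Finset.sum_le_sum fun i _ => ?_
  rw [← Finset.sum_add_sum_compl S, hsub, add_comm]
  refine add_le_add (le_of_eq ?_) ?_
  · simp only [hyx, SimpleGraph.comap_adj, Function.Embedding.subtype_apply]
  · rw [← nsmul_eq_mul]
    refine Finset.sum_le_card_nsmul _ _ _ fun j hj => ?_
    rw [hy0 j hj, hyx]
    split_ifs
    · simp
    · positivity
end

section
/- (Cheeger's Inequality for graphs) Let G be a finite unweighted d-regular simple graph on vertex set V with |V| = n ≥ 2, and let λ_2 be the second smallest eigenvalue of its Laplacian matrix. Define the conductance of a nonempty proper subset S ⊂ V as h_G(S) = |∂S| / min(|S|, |V∖S|), where ∂S is the set of edges with exactly one endpoint in S, and let h(G) = min over nonempty proper subsets S of h_G(S). Then h(G) ≤ √(2 d λ_2); equivalently, there exists a nonempty subset S ⊆ V with |S| ≤ n/2 and |∂S| ≤ √(2 d λ_2) · |S|. -/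
open scoped Matrix

/-- The ordered pairs of adjacent vertices. -/
def adjPairs {V : Type*} [Fintype V] (G : SimpleGraph V) [DecidableRel G.Adj] : Finset (V × V) :=
  Finset.univ.filter fun p => G.Adj p.1 p.2

/-- The pairs of `P` leaving `S`. -/
def leavingPairs {V : Type*} [DecidableEq V] (P : Finset (V × V)) (S : Finset V) :
    Finset (V × V) :=
  P.filter fun p => p.1 ∈ S ∧ p.2 ∉ S

/-- Discrete co-area inequality: an isoperimetric inequality for the subsets of the support of
`h` implies a lower bound on the total positive variation of `h`. -/
theorem mul_sum_lt_sum_max_sub {V : Type*} [Fintype V] [DecidableEq V] (P : Finset (V × V))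
    (c : ℝ) (h : V → ℝ) (h0 : ∀ i, 0 ≤ h i) (hne : ∃ i, h i ≠ 0)
    (hS : ∀ S : Finset V, S.Nonempty → (∀ i ∈ S, 0 < h i) →
      c * S.card < ((leavingPairs P S).card : ℝ)) :
    c * ∑ i, h i < ∑ p ∈ P, max (h p.1 - h p.2) 0 := by
  induction hk : (Finset.univ.filter fun i => 0 < h i).card using Nat.strong_induction_on
    generalizing h with
  | _ k ih =>
  set S := Finset.univ.filter fun i => 0 < h i with hSdef
  have memS : ∀ i, i ∈ S ↔ 0 < h i := by simp [hSdef]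
  have zero_of_notMem : ∀ i, i ∉ S → h i = 0 := fun i hi =>
    le_antisymm (not_lt.1 fun hlt => hi ((memS i).2 hlt)) (h0 i)
  obtain ⟨i0, hi0⟩ := hne
  have Sne : S.Nonempty := ⟨i0, (memS i0).2 ((h0 i0).lt_of_ne' hi0)⟩
  obtain ⟨a, haS, ha⟩ := S.exists_min_image h Sne
  have hm := (memS a).1 haS
  set m := h a with hmdef
  let h' : V → ℝ := fun i => h i - if i ∈ S then m else 0
  have h'0 : ∀ i, 0 ≤ h' i := by
    intro i
    by_cases hi : i ∈ S
    · simpa [h', hi] using ha i hi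
    · simpa [h', hi] using h0 i
  have h'pos : ∀ i, 0 < h' i → 0 < h i := by
    intro i hi
    by_cases hiS : i ∈ S
    · exact (memS i).1 hiS
    · simpa [h', hiS] using hi
  have hsum : ∑ i, h i = ∑ i, h' i + m * S.card := by
    simp [h', Finset.sum_sub_distrib, mul_comm]
  have hvar : ∑ p ∈ P, max (h p.1 - h p.2) 0 =
      ∑ p ∈ P, max (h' p.1 - h' p.2) 0 + m * (leavingPairs P S).card := by
    rw [leavingPairs, Finset.card_filter]
    push_cast
    rw [Finset.mul_sum, ← Finset.sum_add_distrib]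
    refine Finset.sum_congr rfl fun p _ => ?_
    by_cases h1 : p.1 ∈ S <;> by_cases h2 : p.2 ∈ S
    · simp [h', h1, h2]
    · have := ha _ h1
      simp only [h', h1, h2, zero_of_notMem _ h2, if_true, if_false, not_false_eq_true, and_self]
      rw [max_eq_left (by linarith), max_eq_left (by linarith)]
      ring
    · have := ha _ h2
      simp only [h', h1, h2, zero_of_notMem _ h1, if_true, if_false, not_true, and_self]
      rw [max_eq_right (by linarith), max_eq_right (by linarith)]
      simp
    · simp [h', h1, h2, zero_of_notMem]
  have hcut := mul_lt_mul_of_pos_left (hS S Sne fun i hi => (memS i).1 hi) hm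
  have hrest : c * ∑ i, h' i ≤ ∑ p ∈ P, max (h' p.1 - h' p.2) 0 := by
    by_cases hz : ∃ i, h' i ≠ 0
    · refine (ih _ ?_ h' h'0 hz (fun T hT hTpos => hS T hT fun i hi => h'pos i (hTpos i hi))
        rfl).le
      rw [← hk]
      refine Finset.card_lt_card ((Finset.ssubset_iff_of_subset ?_).2 ⟨a, haS, ?_⟩)
      · intro i hi
        exact (memS i).2 (h'pos i (by simpa using hi))
      · simp [h', haS, hmdef]
    · push Not at hz
      simp [hz]
  rw [hsum, hvar]
  linarith [mul_left_comm c m (S.card : ℝ)]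

theorem sum_adjPairs_swap {V : Type*} [Fintype V] (G : SimpleGraph V) [DecidableRel G.Adj]
    (F : V → V → ℝ) : ∑ p ∈ adjPairs G, F p.2 p.1 = ∑ p ∈ adjPairs G, F p.1 p.2 :=
  Finset.sum_equiv (Equiv.prodComm V V) (by simp [adjPairs, G.adj_comm]) (by simp)

theorem sum_adjPairs_fst {V : Type*} [Fintype V] (G : SimpleGraph V) [DecidableRel G.Adj]
    {d : ℕ} (hreg : G.IsRegularOfDegree d) (f : V → ℝ) :
    ∑ p ∈ adjPairs G, f p.1 = d * ∑ i, f i := by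
  rw [adjPairs, Finset.sum_filter, Fintype.sum_prod_type, Finset.mul_sum]
  refine Finset.sum_congr rfl fun i _ => ?_
  rw [← hreg i, G.degree_eq_sum_if_adj, Finset.sum_mul]
  simp

/-- The Dirichlet form of a nonnegative function whose positivity set satisfies an isoperimetric
inequality with constant `√(2dl)` is more than `2l` times its squared norm. -/
theorem lt_sum_adjPairs_sq_sub {V : Type*} [Fintype V] [DecidableEq V] (G : SimpleGraph V)
    [DecidableRel G.Adj] {d : ℕ} (hreg : G.IsRegularOfDegree d) {l : ℝ} (hl : 0 ≤ l)
    (g : V → ℝ) (g0 : ∀ i, 0 ≤ g i) (hne : ∃ i, g i ≠ 0)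
    (hS : ∀ S : Finset V, S.Nonempty → (∀ i ∈ S, 0 < g i) →
      Real.sqrt (2 * d * l) * S.card < ((leavingPairs (adjPairs G) S).card : ℝ)) :
    2 * l * ∑ i, g i ^ 2 < ∑ p ∈ adjPairs G, (g p.1 - g p.2) ^ 2 := by
  by_contra! hE
  have hco := mul_sum_lt_sum_max_sub (adjPairs G) (Real.sqrt (2 * d * l)) (fun i => g i ^ 2)
    (fun i => sq_nonneg _) (hne.imp fun i hi => pow_ne_zero 2 hi)
    (fun S hSn hpos => hS S hSn fun i hi => (g0 i).lt_of_ne' fun h => by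
      simpa [h] using hpos i hi)
  set D := ∑ p ∈ adjPairs G, max (g p.1 ^ 2 - g p.2 ^ 2) 0
  set N := ∑ i, g i ^ 2
  have hN : 0 ≤ N := Finset.sum_nonneg fun i _ => sq_nonneg _
  have habs : ∑ p ∈ adjPairs G, |g p.1 - g p.2| * (g p.1 + g p.2) = 2 * D := by
    have : ∀ p ∈ adjPairs G, |g p.1 - g p.2| * (g p.1 + g p.2) =
        max (g p.1 ^ 2 - g p.2 ^ 2) 0 + max (g p.2 ^ 2 - g p.1 ^ 2) 0 := by
      intro p _
      have h1 := g0 p.1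
      have h2 := g0 p.2
      rcases le_total (g p.1) (g p.2) with h | h
      · rw [abs_of_nonpos (by linarith), max_eq_right (by nlinarith), max_eq_left (by nlinarith)]
        ring
      · rw [abs_of_nonneg (by linarith), max_eq_left (by nlinarith), max_eq_right (by nlinarith)]
        ring
    rw [Finset.sum_congr rfl this, Finset.sum_add_distrib,
      sum_adjPairs_swap G fun i j => max (g i ^ 2 - g j ^ 2) 0]
    ring
  have hcs := Finset.sum_mul_sq_le_sq_mul_sq (adjPairs G) (fun p => |g p.1 - g p.2|)
    (fun p => g p.1 + g p.2)
  simp only [sq_abs] at hcs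
  rw [habs] at hcs
  have hplus : ∑ p ∈ adjPairs G, (g p.1 + g p.2) ^ 2 ≤ 4 * d * N := by
    calc ∑ p ∈ adjPairs G, (g p.1 + g p.2) ^ 2
        ≤ ∑ p ∈ adjPairs G, (2 * g p.1 ^ 2 + 2 * g p.2 ^ 2) :=
          Finset.sum_le_sum fun p _ => by nlinarith [sq_nonneg (g p.1 - g p.2)]
      _ = 4 * d * N := by
          rw [Finset.sum_add_distrib, ← Finset.mul_sum, ← Finset.mul_sum,
            sum_adjPairs_swap G fun i _ => g i ^ 2, sum_adjPairs_fst G hreg fun i => g i ^ 2]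
          ring
  have hprod := mul_le_mul hE hplus (Finset.sum_nonneg fun p _ => sq_nonneg _) (by positivity)
  have hsq := Real.sq_sqrt (show 0 ≤ 2 * (d : ℝ) * l by positivity)
  have hDle : D ^ 2 ≤ (Real.sqrt (2 * d * l) * N) ^ 2 := by
    rw [mul_pow, hsq]
    linarith
  exact absurd hco (not_lt.2 (le_of_abs_le (abs_le_of_sq_le_sq hDle (by positivity))))

theorem exists_median {V : Type*} [Fintype V] [Nonempty V] (f : V → ℝ) :
    ∃ m : ℝ, 2 * (Finset.univ.filter fun i => m < f i).card ≤ Fintype.card V ∧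
      2 * (Finset.univ.filter fun i => f i < m).card ≤ Fintype.card V := by
  classical
  let T : Finset V := Finset.univ.filter fun a =>
    2 * (Finset.univ.filter fun i => f a < f i).card ≤ Fintype.card V
  have hT : T.Nonempty := by
    obtain ⟨a, -, ha⟩ := Finset.univ.exists_max_image f Finset.univ_nonempty
    refine ⟨a, ?_⟩
    have : (Finset.univ.filter fun i => f a < f i) = ∅ := by simpa using ha
    simp [T, this]
  obtain ⟨a, haT, ha⟩ := T.exists_min_image f hT
  refine ⟨f a, by simpa [T] using haT, ?_⟩
  rcases (Finset.univ.filter fun i => f i < f a).eq_empty_or_nonempty with he | hne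
  · simp [he]
  obtain ⟨b, hb, hbmax⟩ := Finset.exists_max_image _ f hne
  have hb' : f b < f a := by simpa using hb
  have hbT : b ∉ T := fun h => absurd (ha b h) (not_le.2 hb')
  have hlarge : Fintype.card V < 2 * (Finset.univ.filter fun i => f b < f i).card := by
    simpa [T] using hbT
  have hdisj : Disjoint (Finset.univ.filter fun i => f b < f i)
      (Finset.univ.filter fun i => f i < f a) := by
    rw [Finset.disjoint_left]
    intro i hi hi'
    exact absurd (hbmax i hi') (not_le.2 (by simpa using hi))
  have := Finset.card_le_univ
    ((Finset.univ.filter fun i => f b < f i) ∪ Finset.univ.filter fun i => f i < f a)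
  rw [Finset.card_union_of_disjoint hdisj] at this
  omega

/-- A nonzero function orthogonal to the constants with Rayleigh quotient at most `l` yields a
small set with small edge boundary. -/
theorem exists_leavingPairs_card_le {V : Type*} [Fintype V] [DecidableEq V] (G : SimpleGraph V)
    [DecidableRel G.Adj] {d : ℕ} (hreg : G.IsRegularOfDegree d) {l : ℝ} (f : V → ℝ)
    (hf : f ≠ 0) (hf1 : ∑ i, f i = 0)
    (hE : ∑ p ∈ adjPairs G, (f p.1 - f p.2) ^ 2 ≤ 2 * l * ∑ i, f i ^ 2) :
    ∃ S : Finset V, S.Nonempty ∧ 2 * S.card ≤ Fintype.card V ∧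
      ((leavingPairs (adjPairs G) S).card : ℝ) ≤ Real.sqrt (2 * d * l) * S.card := by
  by_contra! hcon
  obtain ⟨i0, hi0⟩ := Function.ne_iff.1 hf
  have : Nonempty V := ⟨i0⟩
  have hN : 0 < ∑ i, f i ^ 2 :=
    Finset.sum_pos' (fun i _ => sq_nonneg _) ⟨i0, Finset.mem_univ _, by
      have : f i0 ≠ 0 := hi0
      positivity⟩
  have hE0 : 0 ≤ ∑ p ∈ adjPairs G, (f p.1 - f p.2) ^ 2 :=
    Finset.sum_nonneg fun p _ => sq_nonneg _
  have hl : 0 ≤ l := by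
    by_contra! h
    nlinarith
  obtain ⟨m, hm1, hm2⟩ := exists_median f
  have key : ∀ g : V → ℝ, (∀ i, 0 ≤ g i) → (∃ i, g i ≠ 0) →
      2 * (Finset.univ.filter fun i => 0 < g i).card ≤ Fintype.card V →
      2 * l * ∑ i, g i ^ 2 < ∑ p ∈ adjPairs G, (g p.1 - g p.2) ^ 2 := by
    intro g g0 hne hcard
    refine lt_sum_adjPairs_sq_sub G hreg hl g g0 hne fun S hSn hpos => hcon S hSn ?_
    have : S ⊆ Finset.univ.filter fun i => 0 < g i := fun i hi => by simpa using hpos i hi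
    have := Finset.card_le_card this
    omega
  have key' : ∀ g : V → ℝ, (∀ i, 0 ≤ g i) →
      2 * (Finset.univ.filter fun i => 0 < g i).card ≤ Fintype.card V →
      2 * l * ∑ i, g i ^ 2 ≤ ∑ p ∈ adjPairs G, (g p.1 - g p.2) ^ 2 := by
    intro g g0 hcard
    by_cases hne : ∃ i, g i ≠ 0
    · exact (key g g0 hne hcard).le
    · push Not at hne
      simp [hne]
  let u : V → ℝ := fun i => max (f i - m) 0
  let v : V → ℝ := fun i => max (m - f i) 0
  have u0 : ∀ i, 0 ≤ u i := fun i => le_max_right _ _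
  have v0 : ∀ i, 0 ≤ v i := fun i => le_max_right _ _
  have hu : 2 * (Finset.univ.filter fun i => 0 < u i).card ≤ Fintype.card V := by
    simpa [u] using hm1
  have hv : 2 * (Finset.univ.filter fun i => 0 < v i).card ≤ Fintype.card V := by
    simpa [v] using hm2
  have huv : ∀ i, f i - m = u i - v i ∧ u i * v i = 0 := by
    intro i
    rcases le_total (f i) m with h | h
    · simp only [u, v]
      rw [max_eq_right (by linarith), max_eq_left (by linarith)]
      constructor <;> ring
    · simp only [u, v]
      rw [max_eq_left (by linarith), max_eq_right (by linarith)]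
      constructor <;> ring
  have hnorm : ∑ i, f i ^ 2 ≤ ∑ i, u i ^ 2 + ∑ i, v i ^ 2 := by
    have : ∑ i, u i ^ 2 + ∑ i, v i ^ 2 = ∑ i, (f i ^ 2 - 2 * m * f i + m ^ 2) := by
      rw [← Finset.sum_add_distrib]
      refine Finset.sum_congr rfl fun i _ => ?_
      obtain ⟨h1, h2⟩ := huv i
      have h3 : f i = u i - v i + m := by linarith
      rw [h3]
      linear_combination 2 * h2
    rw [this, Finset.sum_add_distrib, Finset.sum_sub_distrib, ← Finset.mul_sum, hf1]
    have : 0 ≤ ∑ _i : V, m ^ 2 := Finset.sum_nonneg fun _ _ => sq_nonneg _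
    linarith
  have henergy : ∑ p ∈ adjPairs G, (u p.1 - u p.2) ^ 2 + ∑ p ∈ adjPairs G, (v p.1 - v p.2) ^ 2 ≤
      ∑ p ∈ adjPairs G, (f p.1 - f p.2) ^ 2 := by
    rw [← Finset.sum_add_distrib]
    refine Finset.sum_le_sum fun p _ => ?_
    obtain ⟨h1, h2⟩ := huv p.1
    obtain ⟨h3, h4⟩ := huv p.2
    have h5 : f p.1 - f p.2 = (u p.1 - v p.1) - (u p.2 - v p.2) := by linarith
    rw [h5]
    nlinarith [mul_nonneg (u0 p.1) (v0 p.2), mul_nonneg (u0 p.2) (v0 p.1)]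
  have hmul := mul_le_mul_of_nonneg_left hnorm (mul_nonneg zero_le_two hl)
  rw [mul_add] at hmul
  have hu' := key' u u0 hu
  have hv' := key' v v0 hv
  by_cases hune : ∃ i, u i ≠ 0
  · linarith [key u u0 hune hu]
  by_cases hvne : ∃ i, v i ≠ 0
  · linarith [key v v0 hvne hv]
  push Not at hune hvne
  simp only [hune, hvne] at hnorm
  norm_num at hnorm
  linarith

theorem sum_adjPairs_sq_sub_eq {V : Type*} [Fintype V] [DecidableEq V] (G : SimpleGraph V)
    [DecidableRel G.Adj] (f : V → ℝ) :
    ∑ p ∈ adjPairs G, (f p.1 - f p.2) ^ 2 = 2 * (f ⬝ᵥ (G.lapMatrix ℝ *ᵥ f)) := by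
  rw [← Matrix.toLinearMap₂'_apply', G.lapMatrix_toLinearMap₂' ℝ, adjPairs, Finset.sum_filter,
    Fintype.sum_prod_type]
  ring

/-- If a Hermitian matrix has two eigenvalues at most `l`, every linear functional `x ↦ w ⬝ᵥ x`
vanishes at some nonzero vector of Rayleigh quotient at most `l`. -/
theorem exists_ne_zero_dotProduct_mulVec_le {V : Type*} [Fintype V] [DecidableEq V]
    {A : Matrix V V ℝ} (hA : A.IsHermitian) {l : ℝ} {a b : V} (hab : a ≠ b)
    (ha : hA.eigenvalues a ≤ l) (hb : hA.eigenvalues b ≤ l) (w : V → ℝ) :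
    ∃ f : V → ℝ, f ≠ 0 ∧ w ⬝ᵥ f = 0 ∧ f ⬝ᵥ (A *ᵥ f) ≤ l * (f ⬝ᵥ f) := by
  set x : V → ℝ := ⇑(hA.eigenvectorBasis a) with hx
  set y : V → ℝ := ⇑(hA.eigenvectorBasis b) with hy
  have horth : ∀ i j, (⇑(hA.eigenvectorBasis i) : V → ℝ) ⬝ᵥ ⇑(hA.eigenvectorBasis j) =
      if i = j then 1 else 0 := by
    intro i j
    have := (orthonormal_iff_ite.1 hA.eigenvectorBasis.orthonormal) i j
    rw [← this, dotProduct_comm]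
    simp [EuclideanSpace.inner_eq_star_dotProduct]
  have hxx : x ⬝ᵥ x = 1 := by simp [hx, horth]
  have hyy : y ⬝ᵥ y = 1 := by simp [hy, horth]
  have hxy : x ⬝ᵥ y = 0 := by simp [hx, hy, horth, hab]
  have hyx : y ⬝ᵥ x = 0 := by rw [dotProduct_comm, hxy]
  have hAx : A *ᵥ x = hA.eigenvalues a • x := hA.mulVec_eigenvectorBasis a
  have hAy : A *ᵥ y = hA.eigenvalues b • y := hA.mulVec_eigenvectorBasis b
  obtain ⟨s, t, hst, hw⟩ : ∃ s t : ℝ, 0 < s ^ 2 + t ^ 2 ∧ s * (w ⬝ᵥ x) + t * (w ⬝ᵥ y) = 0 := by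
    by_cases h : w ⬝ᵥ x = 0
    · exact ⟨1, 0, by norm_num, by simp [h]⟩
    · exact ⟨-(w ⬝ᵥ y), w ⬝ᵥ x, by positivity, by ring⟩
  have hnorm : (s • x + t • y) ⬝ᵥ (s • x + t • y) = s ^ 2 + t ^ 2 := by
    simp [hxx, hyy, hxy, hyx]
    ring
  refine ⟨s • x + t • y, ?_, by simpa using hw, ?_⟩
  · intro h
    rw [h, zero_dotProduct] at hnorm
    linarith
  · rw [hnorm, Matrix.mulVec_add, Matrix.mulVec_smul, Matrix.mulVec_smul, hAx, hAy]
    simp [hxx, hyy, hxy, hyx]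
    nlinarith [mul_le_mul_of_nonneg_left ha (sq_nonneg s),
      mul_le_mul_of_nonneg_left hb (sq_nonneg t)]

theorem exists_ne_eigenvalues_le {V : Type*} [Fintype V] [DecidableEq V] {A : Matrix V V ℝ}
    (hA : A.IsHermitian) {n : ℕ} (μ : Fin n → ℝ) (hμ : Monotone μ)
    (hroots : A.charpoly.roots = Multiset.map μ Finset.univ.val) (hn : 1 < n) :
    ∃ a b : V, a ≠ b ∧ hA.eigenvalues a ≤ μ ⟨1, hn⟩ ∧ hA.eigenvalues b ≤ μ ⟨1, hn⟩ := by
  classical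
  have hcount : (Finset.univ.filter fun i => hA.eigenvalues i ≤ μ ⟨1, hn⟩).card =
      (Finset.univ.filter fun i => μ i ≤ μ ⟨1, hn⟩).card := by
    have h := congrArg (Multiset.countP (· ≤ μ ⟨1, hn⟩))
      (hA.roots_charpoly_eq_eigenvalues.symm.trans hroots)
    rw [Multiset.countP_map, Multiset.countP_map] at h
    simpa [Finset.card_def] using h
  have htwo : 1 < (Finset.univ.filter fun i => μ i ≤ μ ⟨1, hn⟩).card :=
    Finset.one_lt_card.2 ⟨⟨0, by omega⟩, by simpa using hμ (by simp), ⟨1, hn⟩, by simp, by simp⟩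
  rw [← hcount] at htwo
  obtain ⟨a, ha, b, hb, hab⟩ := Finset.one_lt_card.1 htwo
  exact ⟨a, b, hab, by simpa using ha, by simpa using hb⟩

/-- Cheeger's inequality for graphs: for a `d`-regular graph on `n ≥ 2` vertices
with second smallest Laplacian eigenvalue `λ₂`, the conductance satisfies
`h(G) ≤ √(2 d λ₂)`; equivalently there is a nonempty set `S` with `|S| ≤ n/2`
and `|∂S| ≤ √(2 d λ₂) · |S|`. -/
theorem cheeger_inequality_graphs {V : Type*} [Fintype V] [DecidableEq V]
    (G : SimpleGraph V) [DecidableRel G.Adj]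
    (d : ℕ) (hreg : G.IsRegularOfDegree d) (hn : 2 ≤ Fintype.card V)
    (μ : Fin (Fintype.card V) → ℝ) (hμ : Monotone μ)
    (hroots : (G.lapMatrix ℝ).charpoly.roots = Multiset.map μ Finset.univ.val) :
    sInf {r : ℝ | ∃ S : Finset V, S.Nonempty ∧ S ≠ Finset.univ ∧
        r = ((Finset.univ.filter fun p : V × V =>
                G.Adj p.1 p.2 ∧ p.1 ∈ S ∧ p.2 ∉ S).card : ℝ) /
            min (S.card : ℝ) ((Sᶜ.card : ℝ))} ≤ Real.sqrt (2 * d * μ ⟨1, by omega⟩) ∧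
    ∃ S : Finset V, S.Nonempty ∧ (S.card : ℝ) ≤ (Fintype.card V : ℝ) / 2 ∧
      ((Finset.univ.filter fun p : V × V =>
          G.Adj p.1 p.2 ∧ p.1 ∈ S ∧ p.2 ∉ S).card : ℝ) ≤
        Real.sqrt (2 * d * μ ⟨1, by omega⟩) * (S.card : ℝ) := by
  have hA := G.isHermitian_lapMatrix ℝ
  obtain ⟨a, b, hab, ha, hb⟩ := exists_ne_eigenvalues_le hA μ hμ hroots (by omega)
  obtain ⟨f, hf, hf1, hfE⟩ := exists_ne_zero_dotProduct_mulVec_le hA hab ha hb fun _ => 1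
  obtain ⟨S, hSn, hScard, hS⟩ := exists_leavingPairs_card_le G hreg f hf
    (by simpa [dotProduct] using hf1) (l := μ ⟨1, by omega⟩) (by
      rw [sum_adjPairs_sq_sub_eq]
      simp only [dotProduct, ← sq] at hfE ⊢
      linarith)
  rw [leavingPairs, adjPairs, Finset.filter_filter] at hS
  have hSpos : (0 : ℝ) < S.card := by exact_mod_cast hSn.card_pos
  have hScard' : 2 * (S.card : ℝ) ≤ Fintype.card V := by exact_mod_cast hScard
  refine ⟨?_, S, hSn, by linarith, hS⟩
  refine csInf_le_of_le ⟨0, ?_⟩ ⟨S, hSn, ?_, rfl⟩ ?_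
  · rintro r ⟨T, -, -, rfl⟩
    positivity
  · rintro rfl
    rw [Finset.card_univ] at hScard
    omega
  · have hcompl : (Sᶜ.card : ℝ) = Fintype.card V - S.card := by
      rw [Finset.card_compl, Nat.cast_sub (Finset.card_le_univ S)]
    rw [min_eq_left (by linarith), div_le_iff₀ hSpos]
    exact hS
end

section
/- Let G be a finite unweighted d-regular simple graph on vertex set V with edge set E, let f : V → ℝ be a nonzero vector, and define g : V → ℝ by g(i) = f(i)². Then the L¹ Rayleigh quotient of g satisfies R¹(g) := (∑_{(i,j)∈E} |g(i) − g(j)|) / (∑_{i∈V} g(i)) ≤ √(2 d R(f)), where R(f) = (∑_{(i,j)∈E}(f(i) − f(j))²)/(∑_{i∈V} f(i)²) is the Rayleigh quotient of f. -/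
open scoped Matrix

/-- Weighted handshaking lemma: summing `h` over both endpoints of every edge counts each vertex
with multiplicity its degree. -/
theorem SimpleGraph.sum_edgeFinset_add_eq_sum_degree_mul {V R : Type*} [Fintype V] [DecidableEq V]
    [CommSemiring R] (G : SimpleGraph V) [DecidableRel G.Adj] (h : V → R) :
    ∑ e ∈ G.edgeFinset, Sym2.lift ⟨fun i j => h i + h j, fun _ _ => add_comm _ _⟩ e =
      ∑ v, G.degree v * h v := by
  have endpoints : ∀ e ∈ G.edgeFinset,
      Sym2.lift ⟨fun i j => h i + h j, fun _ _ => add_comm _ _⟩ e =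
        ∑ v, if v ∈ e then h v else 0 := by
    intro e he
    induction e with
    | _ i j =>
      have hij : i ≠ j := (G.mem_edgeSet.1 (SimpleGraph.mem_edgeFinset.1 he)).ne
      have hpair : Finset.univ.filter (fun v => v ∈ s(i, j)) = {i, j} := by
        ext v
        simp
      rw [← Finset.sum_filter, hpair, Finset.sum_pair hij, Sym2.lift_mk]
  rw [Finset.sum_congr rfl endpoints, Finset.sum_comm]
  refine Finset.sum_congr rfl fun v _ => ?_
  rw [← Finset.sum_filter, Finset.sum_const, nsmul_eq_mul, ← G.incidenceFinset_eq_filter,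
    G.card_incidenceFinset_eq_degree]

/-- For a `d`-regular graph and a nonzero vector `f`, the `L¹` Rayleigh quotient
of `g = f²` satisfies `R¹(g) ≤ √(2 d R(f))`, where `R(f)` is the Rayleigh
quotient of `f`. -/
theorem l1_rayleigh_of_square_le_sqrt {V : Type*} [Fintype V] [DecidableEq V]
    (G : SimpleGraph V) [DecidableRel G.Adj]
    (d : ℕ) (hreg : G.IsRegularOfDegree d)
    (f : V → ℝ) (hf : f ≠ 0) (g : V → ℝ) (hg : ∀ i, g i = f i ^ 2) :
    (∑ e ∈ G.edgeFinset,
        Sym2.lift ⟨fun i j => |g i - g j|, fun i j => abs_sub_comm _ _⟩ e) /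
        (∑ i, g i) ≤
      Real.sqrt (2 * d *
        ((∑ e ∈ G.edgeFinset,
            Sym2.lift ⟨fun i j => (f i - f j) ^ 2, fun i j => by ring⟩ e) /
          (∑ i, f i ^ 2))) := by
  obtain rfl : g = fun i => f i ^ 2 := funext hg
  have hpos : 0 < ∑ i, f i ^ 2 := by
    obtain ⟨v, hv⟩ := Function.ne_iff.1 hf
    exact Finset.sum_pos' (fun i _ => sq_nonneg _)
      ⟨v, Finset.mem_univ v, sq_pos_of_ne_zero hv⟩
  have hdeg : ∑ e ∈ G.edgeFinset,
      Sym2.lift ⟨fun i j => f i ^ 2 + f j ^ 2, fun _ _ => add_comm _ _⟩ e =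
        d * ∑ i, f i ^ 2 := by
    rw [G.sum_edgeFinset_add_eq_sum_degree_mul (fun i => f i ^ 2), Finset.mul_sum]
    simp only [hreg.degree_eq]
  have cauchy_schwarz := Finset.sum_sq_le_sum_mul_sum_of_sq_le_mul G.edgeFinset
    (r := Sym2.lift ⟨fun i j => |f i ^ 2 - f j ^ 2|, fun i j => abs_sub_comm _ _⟩)
    (f := Sym2.lift ⟨fun i j => (f i - f j) ^ 2, fun i j => by ring⟩)
    (g := fun e => 2 * Sym2.lift ⟨fun i j => f i ^ 2 + f j ^ 2, fun _ _ => add_comm _ _⟩ e)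
    (fun e _ => by
      induction e with
      | _ i j => exact sq_nonneg (f i - f j))
    (fun e _ => by
      induction e with
      | _ i j =>
        simp only [Sym2.lift_mk]
        positivity)
    (fun e _ => by
      induction e with
      | _ i j =>
        simp only [Sym2.lift_mk, sq_abs]
        nlinarith [mul_nonneg (sq_nonneg (f i - f j)) (sq_nonneg (f i - f j))])
  rw [← Finset.mul_sum, hdeg] at cauchy_schwarz
  apply Real.le_sqrt_of_sq_le
  rw [div_pow, ← mul_div_assoc, div_le_div_iff₀ (by positivity) hpos]
  calc _ ≤ _ := mul_le_mul_of_nonneg_right cauchy_schwarz hpos.le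
    _ = _ := by ring
end

section
/- (Sweep set lemma) Let G be a finite simple graph on vertex set V with edge set E, and let g : V → ℝ be a nonnegative nonzero vector. Then there exists a real t ≥ 0 such that the sweep set S_t = {i ∈ V : g(i) > t} is nonempty and satisfies |∂S_t| / |S_t| ≤ R¹(g), where ∂S_t is the set of edges with exactly one endpoint in S_t and R¹(g) = (∑_{(i,j)∈E}|g(i) − g(j)|)/(∑_{i∈V} g(i)) is the L¹ Rayleigh quotient of g. -/
open scoped Matrix

/-- The edge sum of `|g i - g j|` equals the sum of `g i - g j` over the edges oriented in the
direction of decreasing `g`. -/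
theorem sum_edgeFinset_abs_sub {V : Type*} [Fintype V] [DecidableEq V]
    (G : SimpleGraph V) [DecidableRel G.Adj] (g : V → ℝ) :
    ∑ e ∈ G.edgeFinset, Sym2.lift ⟨fun i j => |g i - g j|, fun _ _ => abs_sub_comm _ _⟩ e =
      ∑ p : V × V with G.Adj p.1 p.2 ∧ g p.2 < g p.1, (g p.1 - g p.2) := by
  have hinj : Set.InjOn (fun p : V × V => s(p.1, p.2))
      (Finset.univ.filter fun p : V × V => G.Adj p.1 p.2 ∧ g p.2 < g p.1) := by
    rintro ⟨a, b⟩ hab ⟨c, d⟩ hcd h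
    simp only [Finset.coe_filter, Finset.mem_univ, true_and, Set.mem_ofPred_eq] at hab hcd
    rcases Sym2.eq_iff.1 h with ⟨rfl, rfl⟩ | ⟨rfl, rfl⟩
    · rfl
    · exact absurd hab.2 hcd.2.not_gt
  symm
  trans ∑ e ∈ (Finset.univ.filter fun p : V × V => G.Adj p.1 p.2 ∧ g p.2 < g p.1).image
      (fun p => s(p.1, p.2)),
      Sym2.lift ⟨fun i j => |g i - g j|, fun _ _ => abs_sub_comm _ _⟩ e
  · rw [Finset.sum_image hinj]
    refine Finset.sum_congr rfl fun p hp => ?_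
    rw [Finset.mem_filter] at hp
    simp [abs_of_pos (sub_pos.2 hp.2.2)]
  · refine Finset.sum_subset ?_ ?_
    · intro e he
      obtain ⟨p, hp, rfl⟩ := Finset.mem_image.1 he
      simpa using (Finset.mem_filter.1 hp).2.1
    · intro e he hne
      induction e using Sym2.ind with
      | _ a b =>
        have hab : G.Adj a b := by simpa using he
        have h1 : ¬ g b < g a := fun h => hne (Finset.mem_image.2 ⟨(a, b), by simp [hab, h], rfl⟩)
        have h2 : ¬ g a < g b := fun h =>
          hne (Finset.mem_image.2 ⟨(b, a), by simp [hab.symm, h], Sym2.eq_swap⟩)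
        simp [le_antisymm (not_lt.1 h1) (not_lt.1 h2)]

/-- Layer-cake formula for finitely many half-open intervals. -/
theorem integral_sum_indicator_Ico {ι : Type*} (s : Finset ι) (a b : ι → ℝ)
    (h : ∀ i ∈ s, a i ≤ b i) :
    MeasureTheory.Integrable
      (fun t : ℝ => ∑ i ∈ s, (Set.Ico (a i) (b i)).indicator (fun _ => (1 : ℝ)) t) ∧
    ∫ t : ℝ, ∑ i ∈ s, (Set.Ico (a i) (b i)).indicator (fun _ => (1 : ℝ)) t =
      ∑ i ∈ s, (b i - a i) := by
  have hint : ∀ i ∈ s, MeasureTheory.Integrable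
      ((Set.Ico (a i) (b i)).indicator (fun _ : ℝ => (1 : ℝ))) := fun i _ =>
    (MeasureTheory.integrable_indicator_iff measurableSet_Ico).2
      (MeasureTheory.integrableOn_const (by simp))
  refine ⟨MeasureTheory.integrable_finsetSum s hint, ?_⟩
  rw [MeasureTheory.integral_finsetSum s hint]
  refine Finset.sum_congr rfl fun i hi => ?_
  rw [MeasureTheory.integral_indicator_const _ measurableSet_Ico,
    Real.volume_real_Ico_of_le (h i hi), smul_eq_mul, mul_one]

/-- Sweep set lemma: for a nonzero nonnegative vector `g` on the vertices of a
finite simple graph, there is a threshold `t ≥ 0` whose sweep set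
`S_t = {i : g(i) > t}` is nonempty and satisfies `|∂S_t| / |S_t| ≤ R¹(g)`. -/
theorem sweep_set_lemma {V : Type*} [Fintype V] [DecidableEq V]
    (G : SimpleGraph V) [DecidableRel G.Adj]
    (g : V → ℝ) (hg : ∀ i, 0 ≤ g i) (hg0 : g ≠ 0) :
    ∃ t : ℝ, 0 ≤ t ∧ {i : V | t < g i}.Nonempty ∧
      ({p : V × V | G.Adj p.1 p.2 ∧ t < g p.1 ∧ ¬ t < g p.2}.ncard : ℝ) /
          ({i : V | t < g i}.ncard : ℝ) ≤
        (∑ e ∈ G.edgeFinset,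
            Sym2.lift ⟨fun i j => |g i - g j|, fun i j => abs_sub_comm _ _⟩ e) /
          (∑ i, g i) := by
  rw [sum_edgeFinset_abs_sub]
  set P : Finset (V × V) := {p : V × V | G.Adj p.1 p.2 ∧ g p.2 < g p.1}
  set N : ℝ := ∑ p ∈ P, (g p.1 - g p.2)
  set S : ℝ := ∑ i, g i
  obtain ⟨k, hk⟩ : ∃ k, 0 < g k := by
    obtain ⟨k, hk⟩ := Function.ne_iff.1 hg0
    exact ⟨k, (hg k).lt_of_ne' hk⟩
  have hS : 0 < S := Finset.sum_pos' (fun i _ => hg i) ⟨k, Finset.mem_univ k, hk⟩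
  by_contra! hcon
  let cut : ℝ → ℝ := fun t =>
    ∑ p ∈ P, (Set.Ico (g p.2) (g p.1)).indicator (fun _ => (1 : ℝ)) t
  let size : ℝ → ℝ := fun t => ∑ i, (Set.Ico 0 (g i)).indicator (fun _ => (1 : ℝ)) t
  have hcut (t : ℝ) :
      ({p : V × V | G.Adj p.1 p.2 ∧ t < g p.1 ∧ g p.2 ≤ t}.ncard : ℝ) = cut t := by
    simp only [cut, Set.indicator_apply, Finset.sum_boole, Set.mem_Ico]
    rw [← Set.ncard_coe_finset]
    congr 2
    ext p
    simp only [P, Finset.coe_filter, Finset.mem_filter, Finset.mem_univ, true_and,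
      Set.mem_ofPred_eq]
    exact ⟨fun h => ⟨⟨h.1, h.2.2.trans_lt h.2.1⟩, h.2.2, h.2.1⟩, fun h => ⟨h.1.1, h.2.2, h.2.1⟩⟩
  have hsize (t : ℝ) (ht : 0 ≤ t) : ({i : V | t < g i}.ncard : ℝ) = size t := by
    simp [size, Set.indicator_apply, ht, Set.ncard_eq_toFinset_card']
  obtain ⟨hcut_int, hcut_eq⟩ := integral_sum_indicator_Ico P (fun p => g p.2) (fun p => g p.1)
    fun p hp => (Finset.mem_filter.1 hp).2.2.le
  obtain ⟨hsize_int, hsize_eq⟩ := integral_sum_indicator_Ico Finset.univ (fun _ => 0) g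
    fun i _ => hg i
  have hpos (t : ℝ) (ht : 0 ≤ t) (hne : {i : V | t < g i}.Nonempty) :
      0 < cut t * S - size t * N := by
    have h := hcon t ht hne
    have hcard : 0 < ({i : V | t < g i}.ncard : ℝ) := by
      exact_mod_cast (Set.ncard_pos).2 hne
    rw [div_lt_div_iff₀ hS hcard, hcut, hsize t ht] at h
    linarith
  have hnonneg : 0 ≤ fun t => cut t * S - size t * N := by
    intro t
    by_cases h : 0 ≤ t ∧ {i : V | t < g i}.Nonempty
    · exact (hpos t h.1 h.2).le
    · have hz : size t = 0 := by
        refine Finset.sum_eq_zero fun i _ => Set.indicator_of_notMem (fun hi => h ?_) _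
        exact ⟨hi.1, i, hi.2⟩
      have : 0 ≤ cut t := Finset.sum_nonneg fun p _ =>
        Set.indicator_nonneg (fun _ _ => zero_le_one) t
      simpa [hz] using mul_nonneg this hS.le
  have hint_pos : 0 < ∫ t, (cut t * S - size t * N) := by
    rw [MeasureTheory.integral_pos_iff_support_of_nonneg hnonneg
      ((hcut_int.mul_const S).sub (hsize_int.mul_const N))]
    refine lt_of_lt_of_le ?_ (MeasureTheory.measure_mono (s := Set.Ico 0 (g k)) ?_)
    · simpa using hk
    · exact fun t ht => (hpos t ht.1 ⟨k, ht.2⟩).ne'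
  rw [MeasureTheory.integral_sub (hcut_int.mul_const S) (hsize_int.mul_const N),
    MeasureTheory.integral_mul_const, MeasureTheory.integral_mul_const,
    hcut_eq, hsize_eq] at hint_pos
  simp only [sub_zero] at hint_pos
  exact absurd hint_pos (by simp [N, S, mul_comm])
end
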